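/- For a finitely generated torsion class T in rep Q, the wide subcategory a(T) consists exactly of those objects of T that can be written as the quotient of a T-split projective object by a T-split projective subobject. -/

import Mathlib

open CategoryTheory CategoryTheory.Limits ZeroObject

attribute [local instance] CategoryTheory.Abelian.hasFiniteBiproducts

noncomputable section

namespace NCPaper

/-- A finite quiver without oriented cycles. -/
structure FinQuiver : Type 1 where
  V : Type
  [quiver : Quiver.{0} V]
  [fintypeV : Fintype V]
  [fintypeArr : ∀ a b : V, Fintype (a ⟶ b)]
  acyclic : ∀ (v : V) (p : Quiver.Path v v), p = Quiver.Path.nil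

attribute [instance] FinQuiver.quiver FinQuiver.fintypeV FinQuiver.fintypeArr

variable (k : Type) [Field k] (Q : FinQuiver)

/-- The ambient abelian category of all `k`-linear representations of `Q`;
finite-dimensional representations are singled out by the predicate `FinDim`. -/
abbrev RepC : Type 1 := Paths Q.V ⥤ ModuleCat.{0} k

variable {k Q}

/-- `M` is a finite-dimensional representation, i.e. an object of `rep Q`. -/
def FinDim (M : RepC k Q) : Prop :=
  ∀ v : Q.V, FiniteDimensional k (M.obj ((Paths.of Q.V).obj v))

section Cat

variable {C : Type*} [Category C] [Abelian C]

/-- `X` is a direct summand of `A`. -/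
def IsSummand (X A : C) : Prop := ∃ (i : X ⟶ A) (r : A ⟶ X), i ≫ r = 𝟙 X

/-- The additive closure of a set of objects: direct summands of finite direct sums. -/
def addSet (S : Set C) : Set C :=
  { X | ∃ (n : ℕ) (f : Fin n → C), (∀ i, f i ∈ S) ∧ IsSummand X (⨁ f) }

/-- `Gen S`: all quotients of objects of the additive closure of `S`. -/
def gen (S : Set C) : Set C := { X | ∃ A ∈ addSet S, ∃ p : A ⟶ X, Epi p }

/-- All morphisms from `A` to `B` vanish. -/
def HomZero (A B : C) : Prop := ∀ f : A ⟶ B, f = 0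

/-- `Ext¹(A, B) = 0`, expressed by the splitting of all short exact sequences
`0 ⟶ B ⟶ E ⟶ A ⟶ 0`. -/
def Ext1Zero (A B : C) : Prop :=
  ∀ (E : C) (i : B ⟶ E) (p : E ⟶ A) (w : i ≫ p = 0),
    (ShortComplex.mk i p w).ShortExact → ∃ r : E ⟶ B, i ≫ r = 𝟙 B

/-- An indecomposable object. -/
def Indec (X : C) : Prop :=
  ¬ IsZero X ∧ ∀ (A B : C), (X ≅ A ⊞ B) → IsZero A ∨ IsZero B

/-- A torsion class: a full subcategory (identified with its set of objects) closed under
direct sums, direct summands, quotients and extensions. -/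
structure IsTorsionClass (T : Set C) : Prop where
  zero_mem : (0 : C) ∈ T
  sum_mem : ∀ X ∈ T, ∀ Y ∈ T, (X ⊞ Y : C) ∈ T
  summand_mem : ∀ X ∈ T, ∀ Y : C, IsSummand Y X → Y ∈ T
  quot_mem : ∀ X ∈ T, ∀ (Y : C) (p : X ⟶ Y), Epi p → Y ∈ T
  ext_mem : ∀ S : ShortComplex C, S.ShortExact → S.X₁ ∈ T → S.X₃ ∈ T → S.X₂ ∈ T

/-- A wide subcategory: a full subcategory (closed under direct sums and summands)
which is exact abelian (closed under kernels and cokernels) and closed under extensions. -/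
structure IsWide (A : Set C) : Prop where
  zero_mem : (0 : C) ∈ A
  sum_mem : ∀ X ∈ A, ∀ Y ∈ A, (X ⊞ Y : C) ∈ A
  summand_mem : ∀ X ∈ A, ∀ Y : C, IsSummand Y X → Y ∈ A
  ker_mem : ∀ X ∈ A, ∀ Y ∈ A, ∀ f : X ⟶ Y, (kernel f : C) ∈ A
  coker_mem : ∀ X ∈ A, ∀ Y ∈ A, ∀ f : X ⟶ Y, (cokernel f : C) ∈ A
  ext_mem : ∀ S : ShortComplex C, S.ShortExact → S.X₁ ∈ A → S.X₃ ∈ A → S.X₂ ∈ A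

/-- `P` is split projective in the subcategory `T`: every epimorphism onto `P`
from an object of `T` splits. -/
def SplitProjIn (T : Set C) (P : C) : Prop :=
  P ∈ T ∧ ∀ X ∈ T, ∀ p : X ⟶ P, Epi p → ∃ s : P ⟶ X, s ≫ p = 𝟙 P

/-- `P` is Ext-projective in the subcategory `T`. -/
def ExtProjIn (T : Set C) (P : C) : Prop := P ∈ T ∧ ∀ X ∈ T, Ext1Zero P X

/-- The subcategory `a(T)` associated to a torsion class `T`. -/
def aSet (T : Set C) : Set C :=
  { B | B ∈ T ∧ ∀ Y ∈ T, ∀ g : Y ⟶ B, (kernel g : C) ∈ T }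

/-- A subcategory is finitely generated if it is generated by a single object of it. -/
def IsFinGen (T : Set C) : Prop := ∃ U ∈ T, T ⊆ gen {U}

/-- `U` is a generator of the subcategory `T`. -/
def IsGenerator (T : Set C) (U : C) : Prop := U ∈ T ∧ T ⊆ gen {U}

/-- `X` is a subquotient of `M`. -/
def IsSubquotient (X M : C) : Prop := ∃ (N : C) (i : N ⟶ M) (p : N ⟶ X), Mono i ∧ Epi p

/-- The support of `M` is contained in the support of `C0`: every simple subquotient
(composition factor) of `M` is a composition factor of `C0`. -/
def SuppLE (M C0 : C) : Prop := ∀ S : C, Simple S → IsSubquotient S M → IsSubquotient S C0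

/-- A partial tilting object of a hereditary category. -/
def IsPartialTilting (T : C) : Prop := Ext1Zero T T

/-- `T` is a tilting object of the full subcategory `A`: it is self-orthogonal and every
(split) projective object of `A` admits a coresolution `0 ⟶ P ⟶ T' ⟶ T'' ⟶ 0` with
`T', T'' ∈ add T`. For `A` the subcategory of representations supported on `supp T`,
this says exactly that `T` is a tilting `kQ/ann T`-module. -/
def TiltingIn (A : Set C) (T : C) : Prop :=
  T ∈ A ∧ Ext1Zero T T ∧
    ∀ P : C, SplitProjIn A P →
      ∃ (T' T'' : C) (_ : T' ∈ addSet {T}) (_ : T'' ∈ addSet {T})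
        (i : P ⟶ T') (p : T' ⟶ T'') (w : i ≫ p = 0),
        (ShortComplex.mk i p w).ShortExact


/-- `U` is the direct sum of one representative of each isomorphism class of
indecomposable Ext-projective objects of `T`. -/
def IsExtProjSum (T : Set C) (U : C) : Prop :=
  ∃ (n : ℕ) (f : Fin n → C),
    (∀ i, Indec (f i) ∧ ExtProjIn T (f i)) ∧
    (∀ i j, Nonempty (f i ≅ f j) → i = j) ∧
    (∀ P : C, Indec P → ExtProjIn T P → ∃ i, Nonempty (P ≅ f i)) ∧
    Nonempty (U ≅ ⨁ f)

/-- A basic object: a direct sum of pairwise non-isomorphic indecomposables. -/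
def IsBasic (U : C) : Prop :=
  ∃ (n : ℕ) (f : Fin n → C), (∀ i, Indec (f i)) ∧
    (∀ i j, Nonempty (f i ≅ f j) → i = j) ∧ Nonempty (U ≅ ⨁ f)

end Cat

/-- A support tilting object of `rep Q`: partial tilting, and tilting as a
`kQ/ann T`-module, i.e. tilting in the subcategory of all finite-dimensional
representations supported on the support of `T`. -/
def IsSupportTilting {k : Type} [Field k] {Q : FinQuiver} (T : RepC k Q) : Prop :=
  IsPartialTilting T ∧ TiltingIn { M : RepC k Q | FinDim M ∧ SuppLE M T } T

section Comb

/-- The dimension vector of a representation. -/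
def dimVec {k : Type} [Field k] {Q : FinQuiver} (M : RepC k Q) : Q.V → ℤ :=
  fun v => (Module.finrank k (M.obj ((Paths.of Q.V).obj v)) : ℤ)

/-- The Euler form of the quiver `Q`. -/
def euler (Q : FinQuiver) {R : Type} [CommRing R] (α β : Q.V → R) : R :=
  (∑ v : Q.V, α v * β v) - ∑ a : (Σ x : Q.V, Σ y : Q.V, x ⟶ y), α a.1 * β a.2.1

/-- The symmetrized Euler form of the quiver `Q`. -/
def symEuler (Q : FinQuiver) {R : Type} [CommRing R] (α β : Q.V → R) : R :=
  euler Q α β + euler Q β α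

/-- The reflection in the vector `v`: `s_v(w) = w - (v, w)·v`. -/
def reflV (Q : FinQuiver) (v : Q.V → ℤ) : (Q.V → ℤ) → (Q.V → ℤ) :=
  fun w => w - symEuler Q v w • v

/-- The composition (product, written from left to right) of a finite sequence of
linear transformations. -/
def comps (Q : FinQuiver) {m : ℕ} (g : Fin m → ((Q.V → ℤ) → (Q.V → ℤ))) :
    (Q.V → ℤ) → (Q.V → ℤ) :=
  (List.ofFn g).foldr (· ∘ ·) id

open scoped Classical in
/-- The simple root at a vertex. -/
def simRoot (Q : FinQuiver) (v : Q.V) : Q.V → ℤ := fun w => if w = v then 1 else 0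

/-- The simple reflection at a vertex. -/
def sref (Q : FinQuiver) (v : Q.V) : (Q.V → ℤ) → (Q.V → ℤ) := reflV Q (simRoot Q v)

/-- An enumeration of the vertices is compatible with the arrows of `Q` if sources
of arrows come before targets. -/
def OrdCompatible (Q : FinQuiver) (ord : Fin (Fintype.card Q.V) ≃ Q.V) : Prop :=
  ∀ (x y : Q.V), (x ⟶ y) → ord.symm x < ord.symm y

/-- The Coxeter element `cox(Q)`: the product of the simple reflections from left to
right in an order compatible with the arrows of `Q`. -/
def coxeter (Q : FinQuiver) (ord : Fin (Fintype.card Q.V) ≃ Q.V) :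
    (Q.V → ℤ) → (Q.V → ℤ) :=
  comps Q fun i => sref Q (ord i)

/-- The product of the simple reflections indexed by a word (a list of vertices). -/
def wordProd (Q : FinQuiver) (l : List Q.V) : (Q.V → ℤ) → (Q.V → ℤ) :=
  (l.map (sref Q)).foldr (· ∘ ·) id

/-- Membership in the Coxeter group `W` (realized faithfully on the root lattice). -/
def InW (Q : FinQuiver) (w : (Q.V → ℤ) → (Q.V → ℤ)) : Prop :=
  ∃ l : List Q.V, w = wordProd Q l

/-- The reflections of `W`: the conjugates of the simple reflections. -/
def IsRefl (Q : FinQuiver) (t : (Q.V → ℤ) → (Q.V → ℤ)) : Prop :=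
  ∃ (l : List Q.V) (i : Q.V), t = wordProd Q l ∘ sref Q i ∘ wordProd Q l.reverse

/-- The absolute length: the least length of an expression as a product of reflections. -/
def ellT (Q : FinQuiver) (w : (Q.V → ℤ) → (Q.V → ℤ)) : ℕ :=
  sInf { m | ∃ f : Fin m → ((Q.V → ℤ) → (Q.V → ℤ)), (∀ i, IsRefl Q (f i)) ∧ w = comps Q f }

/-- The absolute order on `W`. -/
def absLe (Q : FinQuiver) : ((Q.V → ℤ) → (Q.V → ℤ)) → ((Q.V → ℤ) → (Q.V → ℤ)) → Prop :=
  Relation.ReflTransGen fun u v => ∃ t, IsRefl Q t ∧ v = u ∘ t ∧ ellT Q v = ellT Q u + 1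

/-- The noncrossing partitions `NC_Q`: the interval `[e, cox(Q)]` in absolute order. -/
def NCSet (Q : FinQuiver) (ord : Fin (Fintype.card Q.V) ≃ Q.V) :
    Set ((Q.V → ℤ) → (Q.V → ℤ)) :=
  { w | InW Q w ∧ absLe Q w (coxeter Q ord) }

/-- `Q` is of finite (Dynkin) type: the symmetrized Euler form is positive definite. -/
def FiniteType (Q : FinQuiver) : Prop :=
  ∀ α : Q.V → ℚ, α ≠ 0 → 0 < symEuler Q α α

/-- `Q` is of affine (extended Dynkin) type: the symmetrized Euler form is positive
semidefinite with nontrivial radical. -/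
def AffineType (Q : FinQuiver) : Prop :=
  (∀ α : Q.V → ℚ, 0 ≤ symEuler Q α α) ∧ ∃ α : Q.V → ℚ, α ≠ 0 ∧ symEuler Q α α = 0

end Comb

section Statement8



section abs
variable {C : Type*} [Category C] [Abelian C]

/-- Hereditary property. -/
def Hered (C : Type*) [Category C] [Abelian C] : Prop :=
  ∀ (Y P : C) (g : Y ⟶ P), ∃ (E : C) (ι : Y ⟶ E) (h : E ⟶ P) (_ : ι ≫ h = g)
    (w : ι ≫ h ≫ cokernel.π g = 0), Epi h ∧ (ShortComplex.mk ι (h ≫ cokernel.π g) w).ShortExact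

lemma splitProj_mem_aSet (H : Hered C) {T : Set C} (hT : IsTorsionClass T) {P : C}
    (hP : SplitProjIn T P) : P ∈ aSet T := by
  refine ⟨hP.1, fun Y hY g => ?_⟩
  obtain ⟨E, ι, h, e, w, hh, hs⟩ := H Y P g
  have hE : E ∈ T := hT.ext_mem _ hs hY (hT.quot_mem P hP.1 _ (cokernel.π g) inferInstance)
  obtain ⟨t, ht⟩ := hP.2 E hE h hh
  have : Mono ι := hs.mono_f
  obtain ⟨m, hm⟩ : ∃ m : E ⟶ Y, m ≫ ι = 𝟙 E - h ≫ t := by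
    refine ⟨hs.exact.lift (𝟙 E - h ≫ t) ?_, hs.exact.lift_f _ _⟩
    simp [Preadditive.sub_comp, reassoc_of% ht]
  have hmg : m ≫ g = 0 := by
    rw [← e, reassoc_of% hm]
    simp [Preadditive.sub_comp, ht]
  refine hT.summand_mem E hE _ ⟨kernel.ι g ≫ ι, kernel.lift g m hmg, ?_⟩
  rw [← cancel_mono (kernel.ι g), ← cancel_mono ι]
  simp [hm, Preadditive.comp_sub, reassoc_of% e]

lemma splitProj_sub (H : Hered C) {T : Set C} (hT : IsTorsionClass T) {P K : C}
    (hP : SplitProjIn T P) (i : K ⟶ P) [Mono i] (hK : K ∈ T) : SplitProjIn T K := by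
  refine ⟨hK, fun Y hY p hp => ?_⟩
  obtain ⟨E, ι, h, e, w, hh, hs⟩ := H Y P (p ≫ i)
  have hE : E ∈ T := hT.ext_mem _ hs hY (hT.quot_mem P hP.1 _ (cokernel.π (p ≫ i)) inferInstance)
  obtain ⟨t, ht⟩ := hP.2 E hE h hh
  have : Mono ι := hs.mono_f
  have hi : i ≫ cokernel.π (p ≫ i) = 0 := by
    rw [← cancel_epi p, ← Category.assoc, cokernel.condition, comp_zero]
  obtain ⟨s, hs'⟩ : ∃ s : K ⟶ Y, s ≫ ι = i ≫ t := by
    refine ⟨hs.exact.lift (i ≫ t) ?_, hs.exact.lift_f _ _⟩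
    simp [reassoc_of% ht, hi]
  refine ⟨s, ?_⟩
  rw [← cancel_mono i, Category.assoc, ← e, reassoc_of% hs', ht]
  simp

lemma main_abs (H : Hered C) {T : Set C} (hT : IsTorsionClass T)
    (hc : ∀ X ∈ T, ∃ (P : C) (p : P ⟶ X), SplitProjIn T P ∧ Epi p) :
    aSet T = { X : C | X ∈ T ∧
      ∃ (P Q' : C) (i : Q' ⟶ P) (p : P ⟶ X) (w : i ≫ p = 0),
        SplitProjIn T P ∧ SplitProjIn T Q' ∧
        (ShortComplex.mk i p w).ShortExact } := by
  ext X
  constructor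
  · rintro ⟨hX, hk⟩
    obtain ⟨P, p, hP, hp⟩ := hc X hX
    refine ⟨hX, P, kernel p, kernel.ι p, p, kernel.condition p, hP,
      splitProj_sub H hT hP (kernel.ι p) (hk P hP.1 p), ?_⟩
    exact { exact := ShortComplex.exact_kernel p }
  · rintro ⟨hX, P, Q', i, p, w, hP, hQ, hs⟩
    refine ⟨hX, fun Y hY g => ?_⟩
    have : Epi p := hs.epi_g
    have : Mono i := hs.mono_f
    have wi : (0 : Q' ⟶ Y) ≫ g = i ≫ p := by rw [w, zero_comp]
    have hZ : pullback g p ∈ T := by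
      have hl1 := pullback.lift_fst (f := g) (g := p) 0 i wi
      have hl2 := pullback.lift_snd (f := g) (g := p) 0 i wi
      generalize pullback.lift (f := g) (g := p) 0 i wi = l at hl1 hl2
      have : Mono l := mono_of_mono_fac hl2
      refine hT.ext_mem (ShortComplex.mk l (pullback.fst g p) hl1) { exact := ?_ } hQ.1 hY
      refine ShortComplex.exact_of_f_is_kernel _ (KernelFork.IsLimit.ofι' _ _ fun {A} x hx => ?_)
      have hx' : x ≫ pullback.fst g p = 0 := hx
      have hx2 : (x ≫ pullback.snd g p) ≫ p = 0 := by
        rw [Category.assoc, ← pullback.condition, ← Category.assoc, hx', zero_comp]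
      have hf : hs.exact.lift (x ≫ pullback.snd g p) hx2 ≫ i = x ≫ pullback.snd g p :=
        hs.exact.lift_f (x ≫ pullback.snd g p) hx2
      refine ⟨hs.exact.lift (x ≫ pullback.snd g p) hx2, ?_⟩
      apply pullback.hom_ext
      · dsimp only
        rw [Category.assoc, hl1, comp_zero, hx']
      · dsimp only
        rw [Category.assoc, hl2, hf]
    have hk := (splitProj_mem_aSet H hT hP).2 _ hZ (pullback.snd g p)
    have wk : (kernel.ι (pullback.snd g p) ≫ pullback.fst g p) ≫ g = 0 := by
      rw [Category.assoc, pullback.condition, ← Category.assoc, kernel.condition, zero_comp]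
    have w0 : kernel.ι g ≫ g = (0 : kernel g ⟶ P) ≫ p := by rw [kernel.condition, zero_comp]
    refine hT.summand_mem _ hk _ ⟨kernel.lift _ (pullback.lift (kernel.ι g) 0 w0)
      (pullback.lift_snd _ _ _), kernel.lift g _ wk, ?_⟩
    rw [← cancel_mono (kernel.ι g), Category.assoc, kernel.lift_ι, kernel.lift_ι_assoc,
      pullback.lift_fst, Category.id_comp]

end abs

variable {k : Type} [Field k] {Q : FinQuiver}

lemma exact_pointwise (S : ShortComplex (RepC k Q))
    (h : ∀ v, (S.map ((evaluation (Paths Q.V) (ModuleCat.{0} k)).obj v)).Exact) : S.Exact := by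
  rw [ShortComplex.exact_iff_isZero_homology, Functor.isZero_iff]
  intro v
  exact IsZero.of_iso ((ShortComplex.exact_iff_isZero_homology _).1 (h v))
    (S.mapHomologyIso ((evaluation (Paths Q.V) (ModuleCat.{0} k)).obj v)).symm

lemma exists_sec {V W : Type} [AddCommGroup V] [Module k V] [AddCommGroup W] [Module k W]
    (f : V →ₗ[k] W) : ∃ r : W →ₗ[k] V, ∀ x ∈ LinearMap.range f, f (r x) = x := by
  obtain ⟨s, hs⟩ := f.rangeRestrict.exists_rightInverse_of_surjective f.range_rangeRestrict
  obtain ⟨r, hr⟩ := LinearMap.exists_extend s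
  refine ⟨r, fun x hx => ?_⟩
  have h1 : r x = s ⟨x, hx⟩ := by rw [← hr]; rfl
  rw [h1]
  exact congrArg Subtype.val (LinearMap.congr_fun hs ⟨x, hx⟩)

lemma hered : Hered (RepC k Q) := by
  intro Y P g
  let D := cokernel g
  let π : P ⟶ D := cokernel.π g
  have hπ : ∀ v, Function.Surjective (π.app v) := fun v =>
    (ModuleCat.epi_iff_surjective _).1 inferInstance
  have hgπ : ∀ v, ∀ y, π.app v (g.app v y) = 0 := fun v y => by
    exact congrArg (fun f => f.app v y) (cokernel.condition g)
  have hex : ∀ v, ∀ x, π.app v x = 0 → x ∈ LinearMap.range (g.app v).hom := fun v x hx => by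
    have h := (ShortComplex.exact_cokernel g).map ((evaluation (Paths Q.V) (ModuleCat.{0} k)).obj v)
    rw [ShortComplex.moduleCat_exact_iff] at h
    exact h x hx
  choose s hs using fun v => exists_sec (k := k) (π.app v).hom
  choose r hr using fun v => exists_sec (k := k) (g.app v).hom
  replace hs : ∀ v x, π.app v (s v x) = x := fun v x => hs v x (hπ v x)
  replace hr : ∀ v x, π.app v x = 0 → g.app v (r v x) = x := fun v x hx => hr v x (hex v x hx)
  have natπ : ∀ {x y : Paths Q.V} (a : x ⟶ y) z, π.app y (P.map a z) = D.map a (π.app x z) :=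
    fun a z => NatTrans.naturality_apply π a z
  have natg : ∀ {x y : Paths Q.V} (a : x ⟶ y) z, g.app y (Y.map a z) = P.map a (g.app x z) :=
    fun a z => NatTrans.naturality_apply g a z
  let σ : ∀ {x y : Paths Q.V} (a : x ⟶ y), D.obj x →ₗ[k] Y.obj y := fun {x y} a =>
    r y ∘ₗ ((P.map a).hom ∘ₗ s x - s y ∘ₗ (D.map a).hom)
  have hσ : ∀ {x y : Paths Q.V} (a : x ⟶ y) d,
      g.app y (σ a d) = P.map a (s x d) - s y (D.map a d) := fun {x y} a d => by
    refine hr y (P.map a (s x d) - s y (D.map a d)) ?_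
    rw [map_sub, natπ, hs, hs, sub_self]
  have hcomb : ∀ {x y : Paths Q.V} (a : x ⟶ y) (z : Y.obj x) (d : D.obj x),
      g.app y (Y.map a z + σ a d) + s y (D.map a d) = P.map a (g.app x z + s x d) := by
    intro x y a z d
    rw [map_add, map_add, hσ, natg]
    abel
  let φ : Q.V ⥤q ModuleCat.{0} k :=
    { obj := fun v => ModuleCat.of k (Y.obj v × D.obj v)
      map := fun {x y} a => ModuleCat.ofHom
        (LinearMap.prod
          ((Y.map a.toPath).hom ∘ₗ LinearMap.fst k _ _ + σ (x := x) (y := y) a.toPath ∘ₗ LinearMap.snd k _ _)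
          ((D.map a.toPath).hom ∘ₗ LinearMap.snd k _ _)) }
  let E : RepC k Q := Paths.lift φ
  have Emap : ∀ {x y : Q.V} (a : x ⟶ y), E.map a.toPath = φ.map a := fun a => Paths.lift_toPath φ a
  let ι : Y ⟶ E := Paths.liftNatTrans
    (fun v => ModuleCat.ofHom (LinearMap.inl k (Y.obj v) (D.obj v))) (by
      intro x y a
      rw [Emap]
      ext z
      refine Prod.ext ?_ ?_
      · change Y.map a.toPath z = Y.map a.toPath z + σ (x := x) (y := y) a.toPath 0
        simp
      · change 0 = D.map a.toPath 0
        simp)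
  let h : E ⟶ P := Paths.liftNatTrans
    (fun v => ModuleCat.ofHom ((g.app v).hom ∘ₗ LinearMap.fst k (Y.obj v) (D.obj v)
      + s v ∘ₗ LinearMap.snd k (Y.obj v) (D.obj v))) (by
      intro x y a
      rw [Emap]
      ext z
      exact hcomb (x := x) (y := y) a.toPath z.1 z.2)
  have hιh : ι ≫ h = g := by
    ext v z
    change g.app v z + s v 0 = g.app v z
    simp
  have hhπ : ∀ v (z : Y.obj v × D.obj v), (h ≫ π).app v z = z.2 := fun v z => by
    change π.app v (g.app v z.1 + s v z.2) = z.2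
    rw [map_add, hgπ, hs, zero_add]
  refine ⟨E, ι, h, hιh, by rw [reassoc_of% hιh, cokernel.condition], ?_, ?_⟩
  · have : ∀ v, Epi (h.app v) := fun v => by
      rw [ModuleCat.epi_iff_surjective]
      intro z
      refine ⟨((r v (z - s v (π.app v z)), π.app v z) : Y.obj v × D.obj v), ?_⟩
      change g.app v (r v (z - s v (π.app v z))) + s v (π.app v z) = z
      rw [hr]
      · abel
      · rw [map_sub, hs, sub_self]
    exact NatTrans.epi_of_epi_app h
  · have : ∀ v, Mono (ι.app v) := fun v => by
      rw [ModuleCat.mono_iff_injective]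
      exact LinearMap.inl_injective
    have m : Mono ι := NatTrans.mono_of_mono_app ι
    have : ∀ v, Epi ((h ≫ π).app v) := fun v => by
      rw [ModuleCat.epi_iff_surjective]
      intro z
      exact ⟨((0, z) : Y.obj v × D.obj v), hhπ v _⟩
    have e : Epi (h ≫ π) := NatTrans.epi_of_epi_app _
    refine { exact := exact_pointwise _ fun v => ?_, mono_f := m, epi_g := e }
    rw [ShortComplex.moduleCat_exact_iff]
    intro z hz
    have hz2 : (z : Y.obj v × D.obj v).2 = 0 := (hhπ v z).symm.trans hz
    exact ⟨(z : Y.obj v × D.obj v).1, Prod.ext rfl hz2.symm⟩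

lemma biprod_mem {C : Type*} [Category C] [Abelian C] {T : Set C} (hT : IsTorsionClass T) :
    ∀ (n : ℕ) (f : Fin n → C), (∀ i, f i ∈ T) → (⨁ f) ∈ T := by
  intro n
  induction n with
  | zero =>
    intro f _
    refine hT.summand_mem _ hT.zero_mem _ ⟨0, 0, ?_⟩
    apply biproduct.hom_ext
    intro j
    exact j.elim0
  | succ n ih =>
    intro f hf
    refine hT.summand_mem _ (hT.sum_mem _ (hf 0) _ (ih (fun i => f i.succ) fun i => hf _)) _
      ⟨biprod.lift (biproduct.π f 0) (biproduct.lift fun i => biproduct.π f i.succ),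
        biprod.desc (biproduct.ι f 0) (biproduct.desc fun i => biproduct.ι f i.succ), ?_⟩
    rw [biprod.lift_desc, biproduct.lift_desc, ← biproduct.total, Fin.sum_univ_succ]

/-- Evaluation of a morphism at an element. -/
def evl {A : RepC k Q} (B : RepC k Q) {v : Paths Q.V} (x : A.obj v) : (A ⟶ B) →ₗ[k] B.obj v where
  toFun f := f.app v x
  map_add' _ _ := rfl
  map_smul' _ _ := rfl

lemma evl_comp {A B D : RepC k Q} {v : Paths Q.V} (x : A.obj v) (f : A ⟶ B) (g : B ⟶ D) :
    evl D x (f ≫ g) = evl D (evl B x f) g := rfl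

lemma evl_id {A : RepC k Q} {v : Paths Q.V} (x : A.obj v) :
    evl A x (𝟙 A) = x := rfl

lemma evl_arg {A B : RepC k Q} {v : Paths Q.V} (f : A ⟶ B) {ι : Type} (s : Finset ι)
    (x : ι → A.obj v) :
    evl B (∑ i ∈ s, x i) f = ∑ i ∈ s, evl B (x i) f :=
  map_sum (f.app v).hom x s

/-- Versal pointed objects. -/
def Versal (T : Set (RepC k Q)) {J : Type} (v : J → Paths Q.V) (U : RepC k Q)
    (u : ∀ j, U.obj (v j)) : Prop :=
  U ∈ T ∧ ∀ Y ∈ T, ∀ y : ∀ j, Y.obj (v j), ∃ f : U ⟶ Y, ∀ j, evl Y (u j) f = y j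

lemma exists_versal {T : Set (RepC k Q)} (hT : IsTorsionClass T) (hfd : ∀ X ∈ T, FinDim X)
    (hfg : IsFinGen T) {J : Type} [Fintype J] (v : J → Paths Q.V) :
    ∃ U u, Versal T v U u := by
  obtain ⟨U₀, hU₀, hg⟩ := hfg
  have : ∀ j, FiniteDimensional k (U₀.obj (v j)) := fun j => hfd U₀ hU₀ (v j)
  let n := Module.finrank k (∀ j, U₀.obj (v j))
  let e := Module.finBasis k (∀ j, U₀.obj (v j))
  let F : Fin n → RepC k Q := fun _ => U₀
  refine ⟨⨁ F, fun j => ∑ b : Fin n, evl (⨁ F) (e b j) (biproduct.ι F b),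
    biprod_mem hT n F fun _ => hU₀, fun Y hY y => ?_⟩
  obtain ⟨m, q, hq⟩ : ∃ (m : ℕ) (q : (⨁ fun _ : Fin m => U₀) ⟶ Y), Epi q := by
    obtain ⟨A, ⟨m, G, hG, i, r, hir⟩, p, hp⟩ := hg hY
    obtain rfl : G = fun _ => U₀ := funext hG
    have : IsSplitEpi r := IsSplitEpi.mk' ⟨i, hir⟩
    exact ⟨m, r ≫ p, inferInstance⟩
  let G : Fin m → RepC k Q := fun _ => U₀
  have hsurj : ∀ j, ∃ z : (⨁ G).obj (v j), evl Y z q = y j := fun j =>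
    (ModuleCat.epi_iff_surjective (q.app (v j))).1 inferInstance (y j)
  choose z hz using hsurj
  let c : Fin m → Fin n → k := fun a => e.repr (fun j => evl (G a) (z j) (biproduct.π G a))
  have hc : ∀ a j, ∑ b, c a b • (e b j) = evl (G a) (z j) (biproduct.π G a) := fun a j => by
    have := congrFun (e.sum_repr (fun j => evl (G a) (z j) (biproduct.π G a))) j
    rw [← this, Finset.sum_apply]
    rfl
  refine ⟨biproduct.desc (fun b : Fin n => ∑ a : Fin m, c a b • (biproduct.ι G a : U₀ ⟶ ⨁ G))
    ≫ q, fun j => ?_⟩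
  rw [evl_comp, ← hz j]
  refine congrArg (fun t => evl Y t q) ?_
  rw [evl_arg]
  have h1 : ∀ b : Fin n, evl (⨁ G) (evl (⨁ F) (e b j) (biproduct.ι F b))
      (biproduct.desc (fun b : Fin n => ∑ a : Fin m, c a b • (biproduct.ι G a : U₀ ⟶ ⨁ G)))
      = ∑ a : Fin m, c a b • evl (⨁ G) (e b j) (biproduct.ι G a : U₀ ⟶ ⨁ G) := fun b => by
    rw [← evl_comp, biproduct.ι_desc, map_sum]
    rfl
  rw [Finset.sum_congr rfl fun b _ => h1 b, Finset.sum_comm]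
  have h2 : z j = ∑ a, evl (⨁ G) (evl (G a) (z j) (biproduct.π G a)) (biproduct.ι G a) := by
    conv_lhs => rw [← evl_id (z j), ← biproduct.total, map_sum]
    rfl
  conv_rhs => rw [h2]
  refine Finset.sum_congr rfl fun a _ => ?_
  rw [← hc a j, evl_arg]
  refine Finset.sum_congr rfl fun b _ => ?_
  exact (map_smul ((biproduct.ι G a).app (v j)).hom (c a b) (e b j)).symm

/-- Total dimension. -/
def tdim (M : RepC k Q) : ℕ :=
  ∑ v : Q.V, Module.finrank k (M.obj ((Paths.of Q.V).obj v))

lemma isIso_of_mono_tdim {A B : RepC k Q} (m : A ⟶ B) [Mono m] (hA : FinDim A) (hB : FinDim B)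
    (h : tdim B ≤ tdim A) : Epi m := by
  have hinj : ∀ v, Function.Injective (m.app v).hom := fun v =>
    (ModuleCat.mono_iff_injective (m.app v)).1 inferInstance
  have hle : ∀ v : Q.V, Module.finrank k (A.obj ((Paths.of Q.V).obj v)) ≤
      Module.finrank k (B.obj ((Paths.of Q.V).obj v)) := fun v => by
    have := hB v
    exact LinearMap.finrank_le_finrank_of_injective (hinj _)
  have heq := (Finset.sum_eq_sum_iff_of_le fun v _ => hle v).1
    (le_antisymm (Finset.sum_le_sum fun v _ => hle v) h)
  have : ∀ v, Epi (m.app v) := fun v => by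
    rw [ModuleCat.epi_iff_surjective]
    have h1 := hA v
    have h2 := hB v
    exact (LinearMap.injective_iff_surjective_of_finrank_eq_finrank (heq v (Finset.mem_univ _))).1
      (hinj _)
  exact NatTrans.epi_of_epi_app m

lemma isIso_of_epi_endo {A : RepC k Q} (m : A ⟶ A) [Epi m] (hA : FinDim A) : IsIso m := by
  have : ∀ v, Mono (m.app v) := fun v => by
    rw [ModuleCat.mono_iff_injective]
    have h1 : FiniteDimensional k (A.obj v) := hA v
    exact (LinearMap.injective_iff_surjective (f := (m.app v).hom)).2
      ((ModuleCat.epi_iff_surjective (m.app v)).1 inferInstance)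
  have : Mono m := NatTrans.mono_of_mono_app m
  exact isIso_of_mono_of_epi m

lemma exists_cover {T : Set (RepC k Q)} (hT : IsTorsionClass T) (hfd : ∀ X ∈ T, FinDim X)
    (hfg : IsFinGen T) (X : RepC k Q) (hX : X ∈ T) :
    ∃ (P : RepC k Q) (p : P ⟶ X), SplitProjIn T P ∧ Epi p := by
  have hXf : ∀ w : Q.V, FiniteDimensional k (X.obj ((Paths.of Q.V).obj w)) := hfd X hX
  let J := Σ w : Q.V, Fin (Module.finrank k (X.obj ((Paths.of Q.V).obj w)))
  let v : J → Paths Q.V := fun j => (Paths.of Q.V).obj j.1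
  let x : ∀ j, X.obj (v j) := fun j => Module.finBasis k (X.obj ((Paths.of Q.V).obj j.1)) j.2
  classical
  have hex : ∃ n U u, Versal T v U u ∧ tdim U = n := by
    obtain ⟨U, u, h⟩ := exists_versal hT hfd hfg v
    exact ⟨_, U, u, h, rfl⟩
  obtain ⟨U, u, hU, hn⟩ := Nat.find_spec hex
  have hmin : ∀ U' u', Versal T v U' u' → tdim U ≤ tdim U' := fun U' u' h => by
    rw [hn]
    exact Nat.find_min' hex ⟨U', u', h, rfl⟩
  obtain ⟨p, hp⟩ := hU.2 X hX x
  refine ⟨U, p, ⟨hU.1, fun Y hY q hq => ?_⟩, ?_⟩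
  · have hsurj : ∀ j, ∃ y : Y.obj (v j), evl U y q = u j := fun j =>
      (ModuleCat.epi_iff_surjective (q.app (v j))).1 inferInstance (u j)
    choose y hy using hsurj
    obtain ⟨f, hf⟩ := hU.2 Y hY y
    have hfix : ∀ j, evl U (u j) (f ≫ q) = u j := fun j => by rw [evl_comp, hf, hy]
    have hI : image (f ≫ q) ∈ T := hT.quot_mem U hU.1 _ (factorThruImage (f ≫ q)) inferInstance
    have hver : Versal T v (image (f ≫ q)) (fun j => evl _ (u j) (factorThruImage (f ≫ q))) := by
      refine ⟨hI, fun Z hZ z => ?_⟩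
      obtain ⟨t, ht⟩ := hU.2 Z hZ z
      refine ⟨image.ι (f ≫ q) ≫ t, fun j => ?_⟩
      rw [← evl_comp, image.fac_assoc, evl_comp, hfix, ht]
    have h1 := isIso_of_mono_tdim (image.ι (f ≫ q)) (hfd _ hI) (hfd _ hU.1) (hmin _ _ hver)
    have h2 : Epi (f ≫ q) := by
      rw [← image.fac (f ≫ q)]
      exact epi_comp _ _
    have h3 := isIso_of_epi_endo (f ≫ q) (hfd _ hU.1)
    exact ⟨inv (f ≫ q) ≫ f, by rw [Category.assoc, IsIso.inv_hom_id]⟩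
  · have : ∀ w, Epi (p.app w) := fun w => by
      rw [ModuleCat.epi_iff_surjective]
      change Function.Surjective (p.app w).hom
      rw [← LinearMap.range_eq_top, eq_top_iff]
      have := hXf w
      have hb := (Module.finBasis k (X.obj ((Paths.of Q.V).obj w))).span_eq
      refine hb.symm.le.trans (Submodule.span_le.2 ?_)
      rintro _ ⟨b, rfl⟩
      exact ⟨u ⟨w, b⟩, hp ⟨w, b⟩⟩
    exact NatTrans.epi_of_epi_app p

/-- For a finitely generated torsion class `T` in `rep Q`, the wide
subcategory `a(T)` consists exactly of those objects of `T` that can be written as the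
quotient of a `T`-split projective object by a `T`-split projective subobject. -/
theorem statement8 (k : Type) [Field k] [IsAlgClosed k] (Q : FinQuiver)
    (T : Set (RepC k Q)) (hT : IsTorsionClass T) (hfd : ∀ X ∈ T, FinDim X)
    (hfg : IsFinGen T) :
    aSet T = { X : RepC k Q | X ∈ T ∧
      ∃ (P Q' : RepC k Q) (i : Q' ⟶ P) (p : P ⟶ X) (w : i ≫ p = 0),
        SplitProjIn T P ∧ SplitProjIn T Q' ∧
        (ShortComplex.mk i p w).ShortExact } := by
  exact main_abs hered hT (exists_cover hT hfd hfg)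

end Statement8
end NCPaper
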